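/- Let A be a propositional formula built from propositional variables using only the connectives ∧ and ∨, and let v be a Boolean valuation of the propositional variables. If v(A) = true, then both sequents A^{σ_v} ⇒ 1 and 1 ⇒ A^{σ_v} are provable in WL; if v(A) = false, then both sequents A^{σ_v} ⇒ ⊥ and ⊥ ⇒ A^{σ_v} are provable in WL. -/

import Mathlib

inductive WLForm : Type
  | var : Nat → WLForm
  | one : WLForm
  | bot : WLForm
  | conj : WLForm → WLForm → WLForm
  | disj : WLForm → WLForm → WLForm
  | fuse : WLForm → WLForm → WLForm
  | ldiv : WLForm → WLForm → WLForm
  deriving DecidableEq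

/-- The sequent calculus `WL` (weak Lambek): single-conclusion sequents over
`{1, ⊥, ∧, ∨, *, \}`, with initial sequents `φ ⇒ φ`, `Γ, ⊥, Σ ⇒ Δ`, `⇒ 1`,
the cut rule, `(1w)`, the left/right rules for `∧`, `∨`, `*` and `(R\)`.
No structural rules. -/
inductive WL : List WLForm → Option WLForm → Prop
  | id (A : WLForm) : WL [A] (some A)
  | botL (X Y : List WLForm) (D : Option WLForm) : WL (X ++ WLForm.bot :: Y) D
  | oneR : WL [] (some WLForm.one)
  | cut {X Y Z : List WLForm} {D : Option WLForm} {A : WLForm} :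
      WL X (some A) → WL (Y ++ A :: Z) D → WL (Y ++ X ++ Z) D
  | oneW {X Y : List WLForm} {D : Option WLForm} :
      WL (X ++ Y) D → WL (X ++ WLForm.one :: Y) D
  | conjL1 {X Y : List WLForm} {D : Option WLForm} {A : WLForm} (B : WLForm) :
      WL (X ++ A :: Y) D → WL (X ++ WLForm.conj A B :: Y) D
  | conjL2 {X Y : List WLForm} {D : Option WLForm} {B : WLForm} (A : WLForm) :
      WL (X ++ B :: Y) D → WL (X ++ WLForm.conj A B :: Y) D
  | conjR {X : List WLForm} {A B : WLForm} :
      WL X (some A) → WL X (some B) → WL X (some (WLForm.conj A B))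
  | disjL {X Y : List WLForm} {D : Option WLForm} {A B : WLForm} :
      WL (X ++ A :: Y) D → WL (X ++ B :: Y) D → WL (X ++ WLForm.disj A B :: Y) D
  | disjR1 {X : List WLForm} {A : WLForm} (B : WLForm) :
      WL X (some A) → WL X (some (WLForm.disj A B))
  | disjR2 {X : List WLForm} {B : WLForm} (A : WLForm) :
      WL X (some B) → WL X (some (WLForm.disj A B))
  | fuseL {X Y : List WLForm} {D : Option WLForm} {A B : WLForm} :
      WL (X ++ A :: B :: Y) D → WL (X ++ WLForm.fuse A B :: Y) D
  | fuseR {X Y : List WLForm} {A B : WLForm} :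
      WL X (some A) → WL Y (some B) → WL (X ++ Y) (some (WLForm.fuse A B))
  | ldivR {X : List WLForm} {A B : WLForm} :
      WL (A :: X) (some B) → WL X (some (WLForm.ldiv A B))

/-- Formulas built from propositional variables using only `∧` and `∨`. -/
inductive AO : Type
  | var : Nat → AO
  | conj : AO → AO → AO
  | disj : AO → AO → AO

def AO.eval (v : Nat → Bool) : AO → Bool
  | AO.var n => v n
  | AO.conj a b => a.eval v && b.eval v
  | AO.disj a b => a.eval v || b.eval v

/-- `A^{σ_v}`: substitute `1` for atoms assigned true by `v` and `⊥` for atoms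
assigned false. -/
def AO.substV (v : Nat → Bool) : AO → WLForm
  | AO.var n => if v n then WLForm.one else WLForm.bot
  | AO.conj a b => WLForm.conj (a.substV v) (b.substV v)
  | AO.disj a b => WLForm.disj (a.substV v) (b.substV v)

theorem WL.bot_left (D : Option WLForm) : WL [WLForm.bot] D :=
  WL.botL [] [] D

theorem WL.conj_left {A : WLForm} {D : Option WLForm} (B : WLForm) (h : WL [A] D) :
    WL [WLForm.conj A B] D :=
  WL.conjL1 (X := []) (Y := []) B h

theorem WL.conj_right {B : WLForm} {D : Option WLForm} (A : WLForm) (h : WL [B] D) :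
    WL [WLForm.conj A B] D :=
  WL.conjL2 (X := []) (Y := []) A h

theorem WL.disj_elim {A B : WLForm} {D : Option WLForm} (h : WL [A] D) (k : WL [B] D) :
    WL [WLForm.disj A B] D :=
  WL.disjL (X := []) (Y := []) h k

theorem AO.substV_imp_one (A : AO) (v : Nat → Bool) :
    WL [A.substV v] (some WLForm.one) := by
  induction A with
  | var n =>
    unfold AO.substV
    split
    · exact WL.id _
    · exact WL.bot_left _
  | conj a b iha _ => exact WL.conj_left _ iha
  | disj a b iha ihb => exact WL.disj_elim iha ihb

theorem AO.one_imp_substV {A : AO} {v : Nat → Bool} (h : A.eval v = true) :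
    WL [WLForm.one] (some (A.substV v)) := by
  induction A with
  | var n =>
    have hv : v n = true := h
    simpa [AO.substV, hv] using WL.id WLForm.one
  | conj a b iha ihb =>
    simp only [AO.eval, Bool.and_eq_true] at h
    exact WL.conjR (iha h.1) (ihb h.2)
  | disj a b iha ihb =>
    simp only [AO.eval, Bool.or_eq_true] at h
    rcases h with h | h
    · exact WL.disjR1 _ (iha h)
    · exact WL.disjR2 _ (ihb h)

theorem AO.substV_imp_bot {A : AO} {v : Nat → Bool} (h : A.eval v = false) :
    WL [A.substV v] (some WLForm.bot) := by
  induction A with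
  | var n =>
    have hv : v n = false := h
    simpa [AO.substV, hv] using WL.id WLForm.bot
  | conj a b iha ihb =>
    simp only [AO.eval, Bool.and_eq_false_iff] at h
    rcases h with h | h
    · exact WL.conj_left _ (iha h)
    · exact WL.conj_right _ (ihb h)
  | disj a b iha ihb =>
    simp only [AO.eval, Bool.or_eq_false_iff] at h
    exact WL.disj_elim (iha h.1) (ihb h.2)

theorem statement_0 (A : AO) (v : Nat → Bool) :
    (A.eval v = true →
      WL [A.substV v] (some WLForm.one) ∧ WL [WLForm.one] (some (A.substV v))) ∧
    (A.eval v = false →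
      WL [A.substV v] (some WLForm.bot) ∧ WL [WLForm.bot] (some (A.substV v))) := by
  exact ⟨fun h => ⟨A.substV_imp_one v, AO.one_imp_substV h⟩,
    fun h => ⟨AO.substV_imp_bot h, WL.bot_left _⟩⟩
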